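/- Any bounded solution w ∈ L^∞(ℝ × ℝⁿ) of −∂_t² w − Δ_z w + (1/2) W''(u⋆(t)) w = 0 on ℝ × ℝⁿ depends only on t and equals c · u⋆'(t) for some constant c ∈ ℝ. -/

import Mathlib

open Set Filter

/-- The Euclidean Laplacian of `f : ℝⁿ → ℝ` at `z`, as the sum of the second
derivatives along the coordinate directions. -/
noncomputable def euclLap (n : ℕ) (f : EuclideanSpace ℝ (Fin n) → ℝ)
    (z : EuclideanSpace ℝ (Fin n)) : ℝ :=
  ∑ i : Fin n,
    fderiv ℝ (fun x => fderiv ℝ f x (EuclideanSpace.single i (1 : ℝ))) z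
      (EuclideanSpace.single i (1 : ℝ))


noncomputable def D2 {X : Type*} [NormedAddCommGroup X] [NormedSpace ℝ X] (f : X → ℝ) (p v : X) : ℝ :=
  deriv (deriv fun s : ℝ => f (p + s • v)) 0

section basic
variable {X : Type*} [NormedAddCommGroup X] [NormedSpace ℝ X]

lemma line_contDiff {f : X → ℝ} (hf : ContDiff ℝ 2 f) (p v : X) :
    ContDiff ℝ 2 (fun s : ℝ => f (p + s • v)) := by
  have : ContDiff ℝ 2 (fun s : ℝ => p + s • v) := by fun_prop
  exact hf.comp this

lemma C2_deriv {g : ℝ → ℝ} (hg : ContDiff ℝ 2 g) : Differentiable ℝ g ∧ Differentiable ℝ (deriv g) := by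
  have h : ContDiff ℝ (1 + 1) g := by
    have : (1 + 1 : WithTop ℕ∞) = 2 := by norm_num
    rw [this]; exact hg
  refine ⟨hg.differentiable (by norm_num), ?_⟩
  exact ((contDiff_succ_iff_deriv.1 h).2.2).differentiable (by norm_num)

lemma dd_add {g k : ℝ → ℝ} (hg : ContDiff ℝ 2 g) (hk : ContDiff ℝ 2 k) (x : ℝ) :
    deriv (deriv fun s => g s + k s) x = deriv (deriv g) x + deriv (deriv k) x := by
  have h1 : deriv (fun s => g s + k s) = fun s => deriv g s + deriv k s := by
    funext s
    exact deriv_fun_add ((C2_deriv hg).1 s) ((C2_deriv hk).1 s)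
  rw [h1]
  exact deriv_fun_add ((C2_deriv hg).2 x) ((C2_deriv hk).2 x)

lemma D2_add {f g : X → ℝ} (hf : ContDiff ℝ 2 f) (hg : ContDiff ℝ 2 g) (p v : X) :
    D2 (fun q => f q + g q) p v = D2 f p v + D2 g p v :=
  dd_add (line_contDiff hf p v) (line_contDiff hg p v) 0

lemma D2_const_mul (c : ℝ) (f : X → ℝ) (p v : X) :
    D2 (fun q => c * f q) p v = c * D2 f p v := by
  unfold D2
  have : deriv (fun s : ℝ => c * f (p + s • v)) = fun s => c * deriv (fun s : ℝ => f (p + s • v)) s := by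
    funext s; exact deriv_const_mul_field c
  rw [this]; exact deriv_const_mul_field c

lemma D2_quad {f : X → ℝ} {p v : X} (α β γ : ℝ) (h : ∀ s : ℝ, f (p + s • v) = α + β * s + γ * s ^ 2) :
    D2 f p v = 2 * γ := by
  unfold D2
  have h0 : (fun s : ℝ => f (p + s • v)) = fun s => α + β * s + γ * s ^ 2 := funext h
  have h1 : deriv (fun s : ℝ => α + β * s + γ * s ^ 2) = fun s => β + γ * (2 * s) := by
    funext s
    have : HasDerivAt (fun s : ℝ => α + β * s + γ * s ^ 2) (β * 1 + γ * ((2 : ℕ) * s ^ (2 - 1) * 1)) s :=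
      (((hasDerivAt_id s).const_mul β).const_add α).add (((hasDerivAt_id s).pow 2).const_mul γ)
    rw [this.deriv]; norm_num
  rw [h0, h1]
  have : HasDerivAt (fun s : ℝ => β + γ * (2 * s)) (γ * (2 * 1)) 0 :=
    (((hasDerivAt_id (0 : ℝ)).const_mul 2).const_mul γ).const_add β
  rw [this.deriv]; ring

lemma dd_nonneg {g : ℝ → ℝ} (hg : ContDiff ℝ 2 g) (hm : IsLocalMin g 0) : 0 ≤ deriv (deriv g) 0 := by
  by_contra hneg
  push Not at hneg
  have hd : deriv g 0 = 0 := hm.deriv_eq_zero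
  have hM : IsLocalMax g 0 := by
    have := isLocalMax_of_deriv_deriv_neg hneg hd hg.continuous.continuousAt
    exact this
  have he : g =ᶠ[nhds 0] fun _ => g 0 := by
    filter_upwards [hm, hM] with x h1 h2
    exact le_antisymm h2 h1
  have h2 : deriv (deriv g) 0 = deriv (deriv fun _ : ℝ => g 0) 0 := (he.deriv).deriv_eq
  simp at h2
  linarith

lemma D2_nonneg {f : X → ℝ} (hf : ContDiff ℝ 2 f) {p : X} (hm : IsLocalMin f p) (v : X) : 0 ≤ D2 f p v := by
  apply dd_nonneg (line_contDiff hf p v)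
  have hc : Tendsto (fun s : ℝ => p + s • v) (nhds 0) (nhds p) := by
    have : Continuous (fun s : ℝ => p + s • v) := by fun_prop
    simpa using this.tendsto 0
  have := hc.eventually hm
  simpa [IsLocalMin, IsMinFilter] using this

lemma D2_eq_fderiv {f : X → ℝ} (hf : ContDiff ℝ 2 f) (p v : X) :
    fderiv ℝ (fun x => fderiv ℝ f x v) p v = D2 f p v := by
  have key : ∀ (k : X → ℝ), Differentiable ℝ k → ∀ s : ℝ,
      deriv (fun s : ℝ => k (p + s • v)) s = fderiv ℝ k (p + s • v) v := by
    intro k hk s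
    have h1 : HasDerivAt (fun s : ℝ => p + s • v) v s := by
      simpa using ((hasDerivAt_id s).smul_const v).const_add p
    exact ((hk (p + s • v)).hasFDerivAt.comp_hasDerivAt s h1).deriv
  have h1 : ContDiff ℝ 1 (fun x => fderiv ℝ f x v) := by
    have : ContDiff ℝ 1 (fderiv ℝ f) := hf.fderiv_right (by norm_num)
    exact this.clm_apply contDiff_const
  unfold D2
  rw [funext (key f (hf.differentiable (by norm_num)))]
  rw [key (fun x => fderiv ℝ f x v) (h1.differentiable (by norm_num)) 0]
  simp
end basic

noncomputable def LL {n : ℕ} (V : ℝ → ℝ) (f : ℝ × EuclideanSpace ℝ (Fin n) → ℝ)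
    (p : ℝ × EuclideanSpace ℝ (Fin n)) : ℝ :=
  -(D2 f p (1, 0)) - ∑ i : Fin n, D2 f p (0, EuclideanSpace.single i 1) + V p.1 * f p

section main
variable {n : ℕ}

lemma LL_add (V : ℝ → ℝ) {f g : ℝ × EuclideanSpace ℝ (Fin n) → ℝ} (hf : ContDiff ℝ 2 f) (hg : ContDiff ℝ 2 g)
    (p : ℝ × EuclideanSpace ℝ (Fin n)) : LL V (fun q => f q + g q) p = LL V f p + LL V g p := by
  simp only [LL, D2_add hf hg, Finset.sum_add_distrib]; ring

lemma LL_const_mul (V : ℝ → ℝ) (c : ℝ) (f : ℝ × EuclideanSpace ℝ (Fin n) → ℝ)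
    (p : ℝ × EuclideanSpace ℝ (Fin n)) : LL V (fun q => c * f q) p = c * LL V f p := by
  simp only [LL, D2_const_mul, ← Finset.mul_sum]; ring

lemma dd_mul_const (φ : ℝ → ℝ) (c t : ℝ) :
    deriv (deriv fun s => φ (t + s) * c) 0 = deriv (deriv φ) t * c := by
  have h1 : deriv (fun s => φ (t + s) * c) = fun s => deriv φ (t + s) * c := by
    funext s
    rw [deriv_mul_const_field, deriv_comp_const_add]
  rw [h1, deriv_mul_const_field, deriv_comp_const_add]; simp

/-- the operator on separated products -/
lemma LL_prod {V φ : ℝ → ℝ} (hode : ∀ t, deriv (deriv φ) t = V t * φ t)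
    (k : EuclideanSpace ℝ (Fin n) → ℝ) (p : ℝ × EuclideanSpace ℝ (Fin n)) :
    LL V (fun q => φ q.1 * k q.2) p
      = -(φ p.1 * ∑ i : Fin n, D2 k p.2 (EuclideanSpace.single i 1)) := by
  have h1 : D2 (fun q : ℝ × EuclideanSpace ℝ (Fin n) => φ q.1 * k q.2) p (1, 0) = V p.1 * φ p.1 * k p.2 := by
    have := dd_mul_const φ (k p.2) p.1
    rw [hode] at this
    simpa [D2] using this
  have h2 : ∀ i : Fin n, D2 (fun q : ℝ × EuclideanSpace ℝ (Fin n) => φ q.1 * k q.2) p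
      (0, EuclideanSpace.single i 1) = φ p.1 * D2 k p.2 (EuclideanSpace.single i 1) := by
    intro i
    have := D2_const_mul (φ p.1) k p.2 (EuclideanSpace.single i 1)
    rw [← this]
    simp [D2]
  simp only [LL, h1, h2, ← Finset.mul_sum]; ring

lemma MP {V φ : ℝ → ℝ} (hφ : ContDiff ℝ 2 φ) (hpos : ∀ t, 0 < φ t)
    (hode : ∀ t, deriv (deriv φ) t = V t * φ t)
    {h : ℝ × EuclideanSpace ℝ (Fin n) → ℝ} (hh : ContDiff ℝ 2 h)
    {D : Set (ℝ × EuclideanSpace ℝ (Fin n))} (hD : IsClosed D) (B : ℝ)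
    (hb : ∀ p ∈ D, h p < 0 → ‖p‖ ≤ B)
    (hi : ∀ p ∈ D, h p < 0 → p ∈ interior D ∧ 0 < LL V h p) : ∀ p ∈ D, 0 ≤ h p := by
  intro p0 hp0
  by_contra hneg
  push Not at hneg
  have hcomp : IsCompact (D ∩ Metric.closedBall 0 B) := (isCompact_closedBall 0 B).inter_left hD
  have hcont : ContinuousOn (fun p : ℝ × EuclideanSpace ℝ (Fin n) => h p / φ p.1) (D ∩ Metric.closedBall 0 B) := by
    apply Continuous.continuousOn
    exact hh.continuous.div (hφ.continuous.comp continuous_fst) (fun p => (hpos _).ne')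
  obtain ⟨p, hp, hmin⟩ := hcomp.exists_isMinOn ⟨p0, hp0, by simpa using hb p0 hp0 hneg⟩ hcont
  have hp0' : h p / φ p.1 ≤ h p0 / φ p0.1 := hmin ⟨hp0, by simpa using hb p0 hp0 hneg⟩
  have hneg' : h p / φ p.1 < 0 := lt_of_le_of_lt hp0' (div_neg_of_neg_of_pos hneg (hpos _))
  have hpneg : h p < 0 := by
    by_contra hc; push Not at hc
    exact absurd (div_nonneg hc (hpos p.1).le) (not_le.2 hneg')
  obtain ⟨hint, hL⟩ := hi p hp.1 hpneg
  set μ := -(h p / φ p.1) with hμ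
  have hk : ContDiff ℝ 2 (fun q : ℝ × EuclideanSpace ℝ (Fin n) => μ * (φ q.1 * 1)) := by
    have := hφ.comp (contDiff_fst (𝕜 := ℝ) (E := ℝ) (F := EuclideanSpace ℝ (Fin n)))
    exact contDiff_const.mul (this.mul contDiff_const)
  have hzero : h p + μ * (φ p.1 * 1) = 0 := by
    rw [hμ]; have := (hpos p.1).ne'; field_simp; ring
  have hloc : IsLocalMin (fun q => h q + μ * (φ q.1 * 1)) p := by
    filter_upwards [mem_interior_iff_mem_nhds.1 hint] with q hq
    simp only [hzero]
    have hφq := hpos q.1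
    by_cases hqn : h q < 0
    · have : h p / φ p.1 ≤ h q / φ q.1 := hmin ⟨hq, by simpa using hb q hq hqn⟩
      rw [le_div_iff₀ hφq] at this
      rw [hμ]; linarith
    · push Not at hqn
      have : 0 < μ := by rw [hμ]; linarith
      positivity
  have hs := hh.add hk
  have e1 : LL V (fun q => h q + μ * (φ q.1 * 1)) p = LL V h p := by
    rw [LL_add V hh hk, LL_const_mul V μ (fun q => φ q.1 * 1), LL_prod hode (fun _ => 1)]
    have : ∀ i : Fin n, D2 (fun _ : EuclideanSpace ℝ (Fin n) => (1:ℝ)) p.2 (EuclideanSpace.single i 1) = 0 := by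
      intro i; simp [D2]
    simp [this]
  have e2 : LL V (fun q => h q + μ * (φ q.1 * 1)) p ≤ 0 := by
    change _ - _ + V p.1 * (h p + μ * (φ p.1 * 1)) ≤ 0
    rw [hzero]
    have a1 := D2_nonneg hs hloc (1, 0)
    have a2 : 0 ≤ ∑ i : Fin n, D2 (fun q => h q + μ * (φ q.1 * 1)) p (0, EuclideanSpace.single i 1) :=
      Finset.sum_nonneg fun i _ => D2_nonneg hs hloc _
    linarith
  linarith

lemma D2_normsq (z : EuclideanSpace ℝ (Fin n)) (i : Fin n) :
    D2 (fun z : EuclideanSpace ℝ (Fin n) => ‖z‖ ^ 2) z (EuclideanSpace.single i 1) = 2 := by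
  rw [D2_quad (‖z‖ ^ 2) (2 * z i) 1]
  · norm_num
  · intro s
    rw [norm_add_sq_real, inner_smul_right, norm_smul]
    simp [EuclideanSpace.inner_single_right]
    ring

lemma D2_coord (z : EuclideanSpace ℝ (Fin n)) (i j : Fin n) (a b c : ℝ) :
    D2 (fun z : EuclideanSpace ℝ (Fin n) => b * (z i - a) + c * (z i - a) ^ 2) z (EuclideanSpace.single j 1)
      = if i = j then 2 * c else 0 := by
  split_ifs with h
  · subst h
    rw [D2_quad (b * (z i - a) + c * (z i - a) ^ 2) (b + 2 * c * (z i - a)) c]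
    intro s; simp; ring
  · rw [D2_quad (b * (z i - a) + c * (z i - a) ^ 2) 0 0]
    · simp
    · intro s; simp [h]

lemma LL_quad (V : ℝ → ℝ) (A : ℝ) (p : ℝ × EuclideanSpace ℝ (Fin n)) :
    LL V (fun q => A + q.1 ^ 2 + ‖q.2‖ ^ 2) p = -2 - 2 * n + V p.1 * (A + p.1 ^ 2 + ‖p.2‖ ^ 2) := by
  unfold LL
  rw [D2_quad (A + p.1 ^ 2 + ‖p.2‖ ^ 2) (2 * p.1) 1]
  · have : ∀ i : Fin n, D2 (fun q : ℝ × EuclideanSpace ℝ (Fin n) => A + q.1 ^ 2 + ‖q.2‖ ^ 2) p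
      (0, EuclideanSpace.single i 1) = 2 := by
      intro i
      rw [D2_quad (A + p.1 ^ 2 + ‖p.2‖ ^ 2) (2 * p.2 i) 1]
      · norm_num
      · intro s
        simp only [Prod.snd_add, Prod.smul_snd, Prod.fst_add, Prod.smul_fst]
        rw [norm_add_sq_real, inner_smul_right, norm_smul]
        simp [EuclideanSpace.inner_single_right]
        ring
    simp [this]; ring
  · intro s
    simp; ring

lemma LL_tsq (V : ℝ → ℝ) (p : ℝ × EuclideanSpace ℝ (Fin n)) :
    LL V (fun q => q.1 ^ 2) p = -2 + V p.1 * p.1 ^ 2 := by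
  unfold LL
  rw [D2_quad (p.1 ^ 2) (2 * p.1) 1]
  · simp [D2]
  · intro s
    simp; ring
end main

section main2
variable {n : ℕ}

lemma nonneg_of_eps {Q x : ℝ} (h : ∀ ε : ℝ, 0 < ε → 0 ≤ ε * Q + x) : 0 ≤ x := by
  by_contra hx
  push Not at hx
  have hQ : 0 < |Q| + 1 := by positivity
  have h1 := h (-x / (2 * (|Q| + 1))) (div_pos (by linarith) (by positivity))
  have h2 : -x / (2 * (|Q| + 1)) * Q ≤ -x / (2 * (|Q| + 1)) * (|Q| + 1) := by
    apply mul_le_mul_of_nonneg_left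
    · linarith [le_abs_self Q]
    · exact (div_pos (by linarith) (by positivity)).le
  have h3 : -x / (2 * (|Q| + 1)) * (|Q| + 1) = -x / 2 := by field_simp
  linarith

lemma le_of_sq_le {x M : ℝ} (hM : 0 ≤ M) (h : x ^ 2 ≤ M) : |x| ≤ M + 1 := by
  apply abs_le_of_sq_le_sq (by nlinarith) (by linarith)

lemma decay_one {V φ : ℝ → ℝ} (hφ : ContDiff ℝ 2 φ) (hpos : ∀ t, 0 < φ t)
    (hode : ∀ t, deriv (deriv φ) t = V t * φ t) {m T : ℝ} (hm : 0 < m) (hV : ∀ t, T ≤ |t| → m ≤ V t)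
    {F : ℝ × EuclideanSpace ℝ (Fin n) → ℝ} (hF : ContDiff ℝ 2 F) (hL : ∀ p, LL V F p = 0)
    {C K : ℝ} (hC : 0 ≤ C) (hK : 0 ≤ K) (hb : ∀ p, |F p| ≤ C) (hKC : ∀ t, |t| ≤ T → C ≤ K * φ t)
    (p : ℝ × EuclideanSpace ℝ (Fin n)) : F p ≤ K * φ p.1 := by
  by_cases hp : |p.1| ≤ T
  · exact ((le_abs_self _).trans (hb p)).trans (hKC _ hp)
  push Not at hp
  set A : ℝ := (2 * n + 3) / m with hA
  have hApos : 0 < A := by positivity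
  have hmA : m * A = 2 * n + 3 := by rw [hA]; field_simp
  have key : 0 ≤ φ p.1 * K + (-1) * F p := by
    apply nonneg_of_eps (Q := A + p.1 ^ 2 + ‖p.2‖ ^ 2)
    intro ε hε
    have c1 : ContDiff ℝ 2 (fun q : ℝ × EuclideanSpace ℝ (Fin n) => A + q.1 ^ 2 + ‖q.2‖ ^ 2) := by
      have : ContDiff ℝ 2 (fun q : ℝ × EuclideanSpace ℝ (Fin n) => ‖q.2‖ ^ 2) := contDiff_snd.norm_sq ℝ
      exact (contDiff_const.add (contDiff_fst.pow 2)).add this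
    have c1' : ContDiff ℝ 2 (fun q : ℝ × EuclideanSpace ℝ (Fin n) => ε * (A + q.1 ^ 2 + ‖q.2‖ ^ 2)) :=
      contDiff_const.mul c1
    have c2 : ContDiff ℝ 2 (fun q : ℝ × EuclideanSpace ℝ (Fin n) => φ q.1 * K) :=
      (hφ.comp contDiff_fst).mul contDiff_const
    have c3 : ContDiff ℝ 2 (fun q : ℝ × EuclideanSpace ℝ (Fin n) => (-1) * F q) := contDiff_const.mul hF
    refine MP (D := {q : ℝ × EuclideanSpace ℝ (Fin n) | T ≤ |q.1|}) hφ hpos hode (c1'.add (c2.add c3))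
      ?_ (C / ε + 1) ?_ ?_ p hp.le
    · exact isClosed_le continuous_const (continuous_fst.abs)
    · intro q hq hn
      have h1 : 0 < φ q.1 := hpos _
      have h2 := (le_abs_self _).trans (hb q)
      have h3 : ε * (q.1 ^ 2 + ‖q.2‖ ^ 2) ≤ C := by
        have : 0 ≤ φ q.1 * K := by positivity
        have : 0 ≤ ε * A := by positivity
        nlinarith
      have h4 : q.1 ^ 2 + ‖q.2‖ ^ 2 ≤ C / ε := by
        rw [le_div_iff₀ hε]; linarith
      rw [Prod.norm_def]
      apply max_le
      · rw [Real.norm_eq_abs]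
        exact le_of_sq_le (by positivity) (by nlinarith [sq_nonneg ‖q.2‖])
      · have := le_of_sq_le (x := ‖q.2‖) (M := C / ε) (by positivity) (by nlinarith [sq_nonneg q.1])
        rwa [abs_of_nonneg (norm_nonneg _)] at this
    · intro q hq hn
      constructor
      · have hlt : T < |q.1| := by
          by_contra hc
          push Not at hc
          have h1 := hKC _ hc
          have h2 := (le_abs_self _).trans (hb q)
          have : 0 ≤ ε * (A + q.1 ^ 2 + ‖q.2‖ ^ 2) := by positivity
          linarith
        refine mem_interior.2 ⟨{q : ℝ × EuclideanSpace ℝ (Fin n) | T < |q.1|},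
          fun x (hx : T < |x.1|) => (le_of_lt hx : T ≤ |x.1|), ?_, hlt⟩
        exact isOpen_lt continuous_const (continuous_fst.abs)
      · rw [LL_add V c1' (c2.add c3), LL_add V c2 c3, LL_const_mul V ε (fun q => A + q.1 ^ 2 + ‖q.2‖ ^ 2), LL_const_mul, hL,
          LL_quad, LL_prod hode (fun _ => K)]
        have : ∀ i : Fin n, D2 (fun _ : EuclideanSpace ℝ (Fin n) => K) q.2 (EuclideanSpace.single i 1) = 0 := by
          intro i; simp [D2]
        simp only [this, Finset.sum_const_zero, mul_zero, neg_zero, add_zero]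
        apply mul_pos hε
        have h1 : m * A ≤ V q.1 * (A + q.1 ^ 2 + ‖q.2‖ ^ 2) := by
          apply mul_le_mul (hV _ hq) _ hApos.le (hm.le.trans (hV _ hq))
          nlinarith [sq_nonneg q.1, sq_nonneg ‖q.2‖]
        linarith
  linarith

lemma exists_bd {φ : ℝ → ℝ} (f : ℝ → ℝ) (hf : Continuous f) (hφ : Continuous φ) (hpos : ∀ t, 0 < φ t) (T : ℝ) :
    ∃ K : ℝ, 0 ≤ K ∧ ∀ t, |t| ≤ T → f t ≤ K * φ t := by
  have hc : ContinuousOn (fun t => f t / φ t) (Icc (-T) T) :=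
    (hf.div hφ fun t => (hpos t).ne').continuousOn
  obtain ⟨K, hK⟩ := (isCompact_Icc.image_of_continuousOn hc).bddAbove
  refine ⟨max K 0, le_max_right _ _, fun t ht => ?_⟩
  have := hK ⟨t, abs_le.1 ht, rfl⟩
  have h2 := this.trans (le_max_left K 0)
  exact (div_le_iff₀ (hpos t)).1 h2

lemma LL_neg (V : ℝ → ℝ) (f : ℝ × EuclideanSpace ℝ (Fin n) → ℝ)
    (p : ℝ × EuclideanSpace ℝ (Fin n)) : LL V (fun q => - f q) p = - LL V f p := by
  have := LL_const_mul V (-1) f p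
  simpa using this

/-- reflection in the hyperplane of points with i-th coordinate `a` -/
noncomputable def rho (i : Fin n) (a : ℝ) (z : EuclideanSpace ℝ (Fin n)) : EuclideanSpace ℝ (Fin n) :=
  z + (2 * (a - z i)) • EuclideanSpace.single i (1 : ℝ)

lemma rho_contDiff (i : Fin n) (a : ℝ) : ContDiff ℝ 2 (rho i a) := by
  unfold rho
  fun_prop

lemma LL_rho (V : ℝ → ℝ) (f : ℝ × EuclideanSpace ℝ (Fin n) → ℝ) (i : Fin n) (a : ℝ)
    (p : ℝ × EuclideanSpace ℝ (Fin n)) : LL V (fun q => f (q.1, rho i a q.2)) p = LL V f (p.1, rho i a p.2) := by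
  have h1 : D2 (fun q : ℝ × EuclideanSpace ℝ (Fin n) => f (q.1, rho i a q.2)) p (1, 0)
      = D2 f (p.1, rho i a p.2) (1, 0) := by
    simp [D2]
  have h2 : ∀ j, D2 (fun q : ℝ × EuclideanSpace ℝ (Fin n) => f (q.1, rho i a q.2)) p
      (0, EuclideanSpace.single j 1) = D2 f (p.1, rho i a p.2) (0, EuclideanSpace.single j 1) := by
    intro j
    unfold D2
    by_cases hij : i = j
    · subst hij
      have e : (fun s : ℝ => f ((p + s • ((0 : ℝ), EuclideanSpace.single i (1 : ℝ))).1,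
          rho i a (p + s • ((0 : ℝ), EuclideanSpace.single i (1 : ℝ))).2))
          = fun s => (fun s : ℝ => f ((p.1, rho i a p.2) + s • ((0 : ℝ), EuclideanSpace.single i (1 : ℝ)))) (-s) := by
        funext s
        congr 1
        ext1
        · simp
        · simp only [Prod.snd_add, Prod.smul_snd, rho]
          ext l
          simp
          split_ifs <;> ring
      rw [e]
      have e2 : ∀ g : ℝ → ℝ, deriv (deriv fun s => g (-s)) 0 = deriv (deriv g) 0 := by
        intro g
        have : deriv (fun s => g (-s)) = fun s => - deriv g (-s) := by
          funext s; exact deriv_comp_neg g s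
        rw [this, deriv.fun_neg, deriv_comp_neg (deriv g)]
        simp
      exact e2 (fun s : ℝ => f ((p.1, rho i a p.2) + s • ((0 : ℝ), EuclideanSpace.single i (1 : ℝ))))
    · congr 2
      funext s
      refine congrArg f ?_
      ext1
      · simp
      · simp only [Prod.snd_add, Prod.smul_snd, rho]
        ext l
        simp [hij]
        ring
  simp only [LL, h1, h2]

lemma refl_slab {V φ : ℝ → ℝ} (hφ : ContDiff ℝ 2 φ) (hpos : ∀ t, 0 < φ t)
    (hode : ∀ t, deriv (deriv φ) t = V t * φ t)
    {F : ℝ × EuclideanSpace ℝ (Fin n) → ℝ} (hF : ContDiff ℝ 2 F) (hL : ∀ p, LL V F p = 0)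
    {C K A : ℝ} (hC : 0 ≤ C) (hK : 0 ≤ K) (hb : ∀ p, |F p| ≤ C) (hb' : ∀ p, |F p| ≤ K * φ p.1)
    (hA0 : 0 ≤ A) (hA : ∀ t, 2 - V t * t ^ 2 + 2 * n * φ t < 2 * A * φ t)
    (i : Fin n) (a R : ℝ) (hR : 0 < R) (p : ℝ × EuclideanSpace ℝ (Fin n))
    (hp1 : a ≤ p.2 i) (hp2 : p.2 i ≤ a + R) :
    F p - F (p.1, rho i a p.2) ≤ φ p.1 * ((2 * K / R) * (p.2 i - a)) := by
  have hcoord : Continuous (fun q : ℝ × EuclideanSpace ℝ (Fin n) => q.2 i) := by fun_prop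
  have key : 0 ≤ φ p.1 * ((2 * K / R) * (p.2 i - a)) + (-1) * (F p + (-1) * F (p.1, rho i a p.2)) := by
    apply nonneg_of_eps (Q := p.1 ^ 2 + φ p.1 * (‖p.2‖ ^ 2 + A * (R ^ 2 - (p.2 i - a) ^ 2)))
    intro ε hε
    have c1 : ContDiff ℝ 2 (fun q : ℝ × EuclideanSpace ℝ (Fin n) => ε * q.1 ^ 2) := by fun_prop
    have k1 : ContDiff ℝ 2 (fun z : EuclideanSpace ℝ (Fin n) =>
        (2 * K / R) * (z i - a) + (-(ε * A)) * (z i - a) ^ 2) := by fun_prop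
    have k2 : ContDiff ℝ 2 (fun z : EuclideanSpace ℝ (Fin n) => ε * ‖z‖ ^ 2) :=
      contDiff_const.mul (contDiff_id.norm_sq ℝ)
    have k3 : ContDiff ℝ 2 (fun z : EuclideanSpace ℝ (Fin n) => ε * A * R ^ 2) := contDiff_const
    set k : EuclideanSpace ℝ (Fin n) → ℝ := fun z =>
      ((2 * K / R) * (z i - a) + (-(ε * A)) * (z i - a) ^ 2) + (ε * ‖z‖ ^ 2 + ε * A * R ^ 2) with hk
    have ck : ContDiff ℝ 2 k := k1.add (k2.add k3)
    have c2 : ContDiff ℝ 2 (fun q : ℝ × EuclideanSpace ℝ (Fin n) => φ q.1 * k q.2) :=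
      (hφ.comp contDiff_fst).mul (ck.comp contDiff_snd)
    have cF' : ContDiff ℝ 2 (fun q : ℝ × EuclideanSpace ℝ (Fin n) => F (q.1, rho i a q.2)) :=
      hF.comp (contDiff_fst.prodMk ((rho_contDiff i a).comp contDiff_snd))
    have cG : ContDiff ℝ 2 (fun q : ℝ × EuclideanSpace ℝ (Fin n) => F q + (-1) * F (q.1, rho i a q.2)) :=
      hF.add (contDiff_const.mul cF')
    have c3 : ContDiff ℝ 2 (fun q : ℝ × EuclideanSpace ℝ (Fin n) =>
      (-1) * (F q + (-1) * F (q.1, rho i a q.2))) := contDiff_const.mul cG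
    have main := MP (D := {q : ℝ × EuclideanSpace ℝ (Fin n) | a ≤ q.2 i ∧ q.2 i ≤ a + R}) hφ hpos hode
      (c1.add (c2.add c3)) ?_ (2 * C / ε + 2 * K / ε + 1) ?_ ?_ p ⟨hp1, hp2⟩
    · simp only [hk] at main
      linarith
    · exact (isClosed_le continuous_const hcoord).inter (isClosed_le hcoord continuous_const)
    · rintro q ⟨hq1, hq2⟩ hn
      have h1 : 0 < φ q.1 := hpos _
      have h2 := abs_le.1 (hb q)
      have h2' := abs_le.1 (hb (q.1, rho i a q.2))
      have h3 := abs_le.1 (hb' q)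
      have h3' := abs_le.1 (hb' (q.1, rho i a q.2))
      simp only at h3'
      have g1 : 0 ≤ (2 * K / R) * (q.2 i - a) := mul_nonneg (by positivity) (by linarith)
      have g2 : 0 ≤ (ε * A) * (R ^ 2 - (q.2 i - a) ^ 2) := by
        apply mul_nonneg (by positivity)
        nlinarith
      have g3 : ε * ‖q.2‖ ^ 2 ≤ k q.2 := by simp only [hk]; linarith
      have g4 : φ q.1 * (ε * ‖q.2‖ ^ 2) ≤ φ q.1 * k q.2 := mul_le_mul_of_nonneg_left g3 h1.le
      have g5 : 0 ≤ φ q.1 * (ε * ‖q.2‖ ^ 2) := by positivity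
      have g6 : 0 ≤ ε * q.1 ^ 2 := by positivity
      have h4 : q.1 ^ 2 ≤ 2 * C / ε := by
        rw [le_div_iff₀ hε]; linarith
      have h5 : ‖q.2‖ ^ 2 ≤ 2 * K / ε := by
        rw [le_div_iff₀ hε]
        have : φ q.1 * (ε * ‖q.2‖ ^ 2) ≤ φ q.1 * (2 * K) := by linarith
        have := le_of_mul_le_mul_left this h1
        linarith
      have n1 : 0 ≤ 2 * C / ε := by positivity
      have n2 : 0 ≤ 2 * K / ε := by positivity
      rw [Prod.norm_def]
      apply max_le
      · rw [Real.norm_eq_abs]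
        exact le_of_sq_le (by positivity) (by linarith)
      · have := le_of_sq_le (x := ‖q.2‖) (M := 2 * C / ε + 2 * K / ε) (by positivity) (by linarith)
        rwa [abs_of_nonneg (norm_nonneg _)] at this
    · rintro q ⟨hq1, hq2⟩ hn
      have h1 : 0 < φ q.1 := hpos _
      constructor
      · have g6 : 0 ≤ ε * q.1 ^ 2 := by positivity
        have lt1 : a < q.2 i := by
          by_contra hc
          have he : q.2 i = a := le_antisymm (not_lt.1 hc) hq1
          have hr : rho i a q.2 = q.2 := by simp [rho, he]
          have hk0 : 0 ≤ k q.2 := by simp only [hk, he, sub_self]; simp; positivity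
          have : 0 ≤ φ q.1 * k q.2 := by positivity
          rw [hr] at hn
          simp only [Prod.mk.eta] at hn
          linarith
        have lt2 : q.2 i < a + R := by
          by_contra hc
          have he : q.2 i = a + R := le_antisymm hq2 (not_lt.1 hc)
          have h3 := abs_le.1 (hb' q)
          have h3' := abs_le.1 (hb' (q.1, rho i a q.2))
          simp only at h3'
          have hk0 : 2 * K ≤ k q.2 := by
            simp only [hk, he]
            have : 2 * K / R * (a + R - a) = 2 * K := by field_simp; ring
            rw [this]
            have : 0 ≤ ε * ‖q.2‖ ^ 2 := by positivity
            nlinarith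
          have := mul_le_mul_of_nonneg_left hk0 h1.le
          linarith
        refine mem_interior.2 ⟨{q : ℝ × EuclideanSpace ℝ (Fin n) | a < q.2 i ∧ q.2 i < a + R},
          fun x hx => ⟨hx.1.le, hx.2.le⟩, ?_, ⟨lt1, lt2⟩⟩
        exact (isOpen_lt continuous_const hcoord).inter (isOpen_lt hcoord continuous_const)
      · rw [LL_add V c1 (c2.add c3), LL_add V c2 c3, LL_const_mul V ε (fun q => q.1 ^ 2), LL_tsq,
          LL_const_mul V (-1) (fun q => F q + (-1) * F (q.1, rho i a q.2)),
          LL_add V hF (contDiff_const.mul cF'), LL_const_mul V (-1) (fun q => F (q.1, rho i a q.2)),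
          LL_rho, hL, hL, LL_prod hode k]
        have hD : ∀ j : Fin n, D2 k q.2 (EuclideanSpace.single j 1)
            = (if i = j then 2 * (-(ε * A)) else 0) + ε * 2 := by
          intro j
          rw [hk, D2_add k1 (k2.add k3), D2_coord, D2_add k2 k3, D2_const_mul, D2_normsq]
          simp [D2]
        simp only [hD, Finset.sum_add_distrib, Finset.sum_ite_eq, Finset.mem_univ, if_true, Finset.sum_const,
          Finset.card_univ, Fintype.card_fin, nsmul_eq_mul]
        have := mul_pos hε (sub_pos.2 (hA q.1))
        nlinarith
  linarith

lemma refl_le {V φ : ℝ → ℝ} (hφ : ContDiff ℝ 2 φ) (hpos : ∀ t, 0 < φ t)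
    (hode : ∀ t, deriv (deriv φ) t = V t * φ t)
    {F : ℝ × EuclideanSpace ℝ (Fin n) → ℝ} (hF : ContDiff ℝ 2 F) (hL : ∀ p, LL V F p = 0)
    {C K A : ℝ} (hC : 0 ≤ C) (hK : 0 ≤ K) (hb : ∀ p, |F p| ≤ C) (hb' : ∀ p, |F p| ≤ K * φ p.1)
    (hA0 : 0 ≤ A) (hA : ∀ t, 2 - V t * t ^ 2 + 2 * n * φ t < 2 * A * φ t)
    (i : Fin n) (a : ℝ) (p : ℝ × EuclideanSpace ℝ (Fin n))
    (hp1 : a ≤ p.2 i) : F p ≤ F (p.1, rho i a p.2) := by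
  have : 0 ≤ -(F p - F (p.1, rho i a p.2)) := by
    apply nonneg_of_eps (Q := φ p.1 * (2 * K * (p.2 i - a)))
    intro ε hε
    have hR : 0 < 1 / ε + (p.2 i - a) := by
      have : 0 < 1 / ε := by positivity
      linarith
    have h := refl_slab hφ hpos hode hF hL hC hK hb hb' hA0 hA i a (1 / ε + (p.2 i - a)) hR p hp1
      (by have : 0 < 1 / ε := by positivity
          linarith)
    have h2 : 1 / (1 / ε + (p.2 i - a)) ≤ ε := by
      rw [div_le_iff₀ hR]
      have : ε * (1 / ε) = 1 := by field_simp
      nlinarith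
    have h3 : 0 ≤ φ p.1 * (2 * K * (p.2 i - a)) :=
      mul_nonneg (hpos _).le (mul_nonneg (by positivity) (by linarith))
    have h4 := mul_le_mul_of_nonneg_right h2 h3
    have h5 : φ p.1 * (2 * K / (1 / ε + (p.2 i - a)) * (p.2 i - a))
      = 1 / (1 / ε + (p.2 i - a)) * (φ p.1 * (2 * K * (p.2 i - a))) := by
      ring
    linarith
  linarith

lemma indep {V φ : ℝ → ℝ} (hφ : ContDiff ℝ 2 φ) (hpos : ∀ t, 0 < φ t)
    (hode : ∀ t, deriv (deriv φ) t = V t * φ t)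
    {F : ℝ × EuclideanSpace ℝ (Fin n) → ℝ} (hF : ContDiff ℝ 2 F) (hL : ∀ p, LL V F p = 0)
    {C K A : ℝ} (hC : 0 ≤ C) (hK : 0 ≤ K) (hb : ∀ p, |F p| ≤ C) (hb' : ∀ p, |F p| ≤ K * φ p.1)
    (hA0 : 0 ≤ A) (hA : ∀ t, 2 - V t * t ^ 2 + 2 * n * φ t < 2 * A * φ t)
    (t : ℝ) (z : EuclideanSpace ℝ (Fin n)) : F (t, z) = F (t, 0) := by
  have h1 : ∀ (i : Fin n) (a : ℝ) (z : EuclideanSpace ℝ (Fin n)), a ≤ z i → F (t, z) = F (t, rho i a z) := by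
    intro i a z hz
    apply le_antisymm
    · exact refl_le hφ hpos hode hF hL hC hK hb hb' hA0 hA i a (t, z) hz
    · have := refl_le hφ hpos hode hF.neg (fun p => by rw [LL_neg, hL, neg_zero]) hC hK
        (fun p => by rw [abs_neg]; exact hb p) (fun p => by rw [abs_neg]; exact hb' p) hA0 hA i a (t, z) hz
      simp only at this
      linarith
  have h2 : ∀ (i : Fin n) (s : ℝ) (z : EuclideanSpace ℝ (Fin n)), s ≤ 0 →
      F (t, z) = F (t, z + s • EuclideanSpace.single i 1) := by
    intro i s z hs
    rw [h1 i (z i + s / 2) z (by linarith), rho]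
    congr 5
    ring
  have h3 : ∀ (i : Fin n) (s : ℝ) (z : EuclideanSpace ℝ (Fin n)),
      F (t, z) = F (t, z + s • EuclideanSpace.single i 1) := by
    intro i s z
    rcases le_total s 0 with hs | hs
    · exact h2 i s z hs
    · have := h2 i (-s) (z + s • EuclideanSpace.single i 1) (by linarith)
      rw [this]
      congr 2
      simp
  have h4 : ∀ S : Finset (Fin n), F (t, ∑ i ∈ S, z i • EuclideanSpace.single i 1) = F (t, 0) := by
    intro S
    induction S using Finset.induction_on with
    | empty => simp
    | insert i S hi ih => rw [Finset.sum_insert hi, add_comm, ← h3, ih]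
  have h5 : ∑ i, z i • EuclideanSpace.single i (1 : ℝ) = z := by
    ext j
    simp [Finset.sum_apply, Pi.single_apply]
  rw [← h4 Finset.univ, h5]

lemma ode_step {V φ v : ℝ → ℝ} (hφ : ContDiff ℝ 2 φ) (hpos : ∀ t, 0 < φ t)
    (hode : ∀ t, deriv (deriv φ) t = V t * φ t) (hv : ContDiff ℝ 2 v)
    (hvode : ∀ t, deriv (deriv v) t = V t * v t) {K M : ℝ} (hM : ∀ t, φ t ≤ M)
    (hK : ∀ t, |v t| ≤ K * φ t) : ∃ c, ∀ t, v t = c * φ t := by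
  obtain ⟨dφ, ddφ⟩ := C2_deriv hφ
  obtain ⟨dv, ddv⟩ := C2_deriv hv
  have hw : ∀ t, HasDerivAt (fun t => deriv v t * φ t - v t * deriv φ t) 0 t := by
    intro t
    have := (((ddv t).hasDerivAt).mul (dφ t).hasDerivAt).sub ((dv t).hasDerivAt.mul (ddφ t).hasDerivAt)
    rw [hode, hvode] at this
    have e : V t * v t * φ t + deriv v t * deriv φ t - (deriv v t * deriv φ t + v t * (V t * φ t)) = 0 := by ring
    rw [e] at this
    exact this
  obtain ⟨c0, hc0⟩ : ∃ c0, ∀ t, deriv v t * φ t - v t * deriv φ t = c0 :=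
    ⟨_, fun t => is_const_of_deriv_eq_zero (fun t => (hw t).differentiableAt) (fun t => (hw t).deriv) t 0⟩
  have hq : ∀ t, HasDerivAt (fun t => v t / φ t) (c0 / φ t ^ 2) t := by
    intro t
    have := (dv t).hasDerivAt.div (dφ t).hasDerivAt (hpos t).ne'
    rw [hc0 t] at this
    exact this
  have hqb : ∀ t, |v t / φ t| ≤ K := by
    intro t
    rw [abs_div, abs_of_pos (hpos t), div_le_iff₀ (hpos t)]
    exact hK t
  have hMpos : 0 < M := (hpos 0).trans_le (hM 0)
  have hK0 : 0 ≤ K := (abs_nonneg _).trans (hqb 0)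
  have hc : c0 = 0 := by
    by_contra hne
    set r := (2 * K + 1) * M ^ 2 / |c0| with hr
    have hc0p : 0 < |c0| := abs_pos.2 hne
    have hrpos : 0 < r := by positivity
    obtain ⟨x, -, hx⟩ := exists_hasDerivAt_eq_slope (fun t => v t / φ t) (fun t => c0 / φ t ^ 2) hrpos
      (fun t _ => (hq t).continuousAt.continuousWithinAt) (fun t _ => hq t)
    have e1 : |c0| / M ^ 2 ≤ |c0 / φ x ^ 2| := by
      rw [abs_div, abs_of_pos (pow_pos (hpos x) 2)]
      apply div_le_div_of_nonneg_left hc0p.le (pow_pos (hpos x) 2)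
      exact pow_le_pow_left₀ (hpos x).le (hM x) 2
    rw [hx, abs_div, sub_zero, abs_of_pos hrpos, le_div_iff₀ hrpos] at e1
    have e2 : |c0| / M ^ 2 * r = 2 * K + 1 := by rw [hr]; field_simp
    have e3 := abs_sub (v r / φ r) (v 0 / φ 0)
    have := hqb r
    have := hqb 0
    linarith
  refine ⟨v 0 / φ 0, fun t => ?_⟩
  have := is_const_of_deriv_eq_zero (f := fun t => v t / φ t) (fun t => (hq t).differentiableAt)
    (fun t => by rw [(hq t).deriv, hc]; simp) t 0
  rw [← this, div_mul_cancel₀ _ (hpos t).ne']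

lemma abstract_main {V φ : ℝ → ℝ} (hφ : ContDiff ℝ 2 φ) (hpos : ∀ t, 0 < φ t)
    (hode : ∀ t, deriv (deriv φ) t = V t * φ t) (hVc : Continuous V) {m T M : ℝ} (hm : 0 < m)
    (hV : ∀ t, T ≤ |t| → m ≤ V t) (hM : ∀ t, φ t ≤ M)
    {F : ℝ × EuclideanSpace ℝ (Fin n) → ℝ} (hF : ContDiff ℝ 2 F) (hL : ∀ p, LL V F p = 0)
    {C : ℝ} (hb : ∀ p, |F p| ≤ C) : ∃ c, ∀ p, F p = c * φ p.1 := by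
  have hC : 0 ≤ C := (abs_nonneg _).trans (hb 0)
  obtain ⟨K, hK, hKC⟩ := exists_bd (fun _ => C) continuous_const hφ.continuous hpos T
  have hb' : ∀ p, |F p| ≤ K * φ p.1 := by
    intro p
    rw [abs_le']
    refine ⟨decay_one hφ hpos hode hm hV hF hL hC hK hb hKC p, ?_⟩
    exact decay_one hφ hpos hode hm hV hF.neg (fun p => by rw [LL_neg, hL, neg_zero]) hC hK
      (fun p => by rw [abs_neg]; exact hb p) hKC p
  obtain ⟨A1, hA1, hA1'⟩ := exists_bd (fun t => 2 - V t * t ^ 2) (by fun_prop) hφ.continuous hpos (max T (2 / m + 1))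
  have hA : ∀ t, 2 - V t * t ^ 2 + 2 * n * φ t < 2 * (A1 + n + 1) * φ t := by
    intro t
    have hp := hpos t
    have : 2 - V t * t ^ 2 ≤ A1 * φ t := by
      by_cases ht : |t| ≤ max T (2 / m + 1)
      · exact hA1' t ht
      · push Not at ht
        have t1 : T ≤ |t| := (le_max_left _ _).trans ht.le
        have t2 : 2 / m + 1 ≤ |t| := (le_max_right _ _).trans ht.le
        have t3 : 2 / m ≤ t ^ 2 := by
          rw [← sq_abs]
          have : 0 < 2 / m := by positivity
          nlinarith
        have t4 : m * (2 / m) ≤ V t * t ^ 2 := mul_le_mul (hV t t1) t3 (by positivity) (hm.le.trans (hV t t1))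
        have t5 : m * (2 / m) = 2 := by field_simp
        have : 0 ≤ A1 * φ t := by positivity
        linarith
    nlinarith [mul_nonneg hA1 hp.le]
  have hind := fun t z => indep hφ hpos hode hF hL hC hK hb hb' (by positivity) hA t z
  have hv : ContDiff ℝ 2 (fun t => F (t, 0)) := hF.comp (contDiff_id.prodMk contDiff_const)
  have hvode : ∀ t, deriv (deriv fun t => F (t, 0)) t = V t * F (t, 0) := by
    intro t
    have h := hL (t, 0)
    unfold LL at h
    have e1 : D2 F (t, 0) (1, 0) = deriv (deriv fun t => F (t, 0)) t := by
      have := dd_mul_const (fun t => F (t, 0)) 1 t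
      simpa [D2] using this
    have e2 : ∀ i : Fin n, D2 F (t, 0) (0, EuclideanSpace.single i 1) = 0 := by
      intro i
      rw [D2_quad (F (t, 0)) 0 0]
      · simp
      · intro s
        have := hind t (s • EuclideanSpace.single i 1)
        simpa using this
    simp only [e1, e2, Finset.sum_const_zero] at h
    linarith
  obtain ⟨c, hc⟩ := ode_step hφ hpos hode hv hvode hM (fun t => hb' (t, 0))
  exact ⟨c, fun p => (hind p.1 p.2).trans (hc p.1)⟩
end main2

/-- De Giorgi-type rigidity: any bounded solution of
`−∂_t² w − Δ_z w + (1/2) W''(u⋆(t)) w = 0` on `ℝ × ℝⁿ` depends only on `t` and is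
a constant multiple of `u⋆'`. -/
theorem bounded_solutions_on_RxRn_are_multiples_of_wstar
    (W : ℝ → ℝ) (hW : ContDiff ℝ (⊤ : ℕ∞) W)
    (hW1 : W 1 = 0) (hWm1 : W (-1) = 0)
    (hWpos : ∀ x ∈ Set.Ioo (-1 : ℝ) 1, 0 < W x)
    (hW''1 : 0 < deriv (deriv W) 1) (hW''m1 : 0 < deriv (deriv W) (-1))
    (u : ℝ → ℝ) (hu : ContDiff ℝ (⊤ : ℕ∞) u)
    (hode : ∀ t, deriv (deriv u) t = (1 / 2) * deriv W (u t))
    (hfirst : ∀ t, (deriv u t) ^ 2 = W (u t))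
    (hu0 : u 0 = 0) (hmono : StrictMono u)
    (hlimtop : Tendsto u atTop (nhds 1)) (hlimbot : Tendsto u atBot (nhds (-1)))
    (n : ℕ)
    (w : ℝ → EuclideanSpace ℝ (Fin n) → ℝ)
    (hwreg : ContDiff ℝ 2 (fun p : ℝ × EuclideanSpace ℝ (Fin n) => w p.1 p.2))
    (heq : ∀ (t : ℝ) (z : EuclideanSpace ℝ (Fin n)),
      -(deriv (deriv (fun s => w s z)) t) - euclLap n (w t) z
        + (1 / 2) * deriv (deriv W) (u t) * w t z = 0)
    (C : ℝ)
    (hbound : ∀ (t : ℝ) (z : EuclideanSpace ℝ (Fin n)), |w t z| ≤ C) :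
    ∃ c : ℝ, ∀ (t : ℝ) (z : EuclideanSpace ℝ (Fin n)), w t z = c * deriv u t := by
  have hbd : ∀ t, u t ∈ Set.Ioo (-1 : ℝ) 1 := by
    intro t
    constructor
    · have h1 : -1 ≤ u (t - 1) := hmono.monotone.le_of_tendsto hlimbot (t - 1)
      exact h1.trans_lt (hmono (by linarith))
    · have h1 : u (t + 1) ≤ 1 := hmono.monotone.ge_of_tendsto hlimtop (t + 1)
      exact (hmono (by linarith)).trans_le h1
  have hu' : ContDiff ℝ (⊤ : ℕ∞) (deriv u) := (contDiff_infty_iff_deriv.1 hu).2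
  have hW' : ContDiff ℝ (⊤ : ℕ∞) (deriv W) := (contDiff_infty_iff_deriv.1 hW).2
  have hW'' : ContDiff ℝ (⊤ : ℕ∞) (deriv (deriv W)) := (contDiff_infty_iff_deriv.1 hW').2
  have hφ : ContDiff ℝ 2 (deriv u) := by exact_mod_cast contDiff_infty.1 hu' 2
  have hpos : ∀ t, 0 < deriv u t := by
    intro t
    have h1 : 0 ≤ deriv u t := hmono.monotone.deriv_nonneg
    have h2 := hfirst t
    have h3 := hWpos _ (hbd t)
    rcases h1.lt_or_eq with h | h
    · exact h
    · rw [← h] at h2; norm_num at h2; linarith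
  have hφode : ∀ t, deriv (deriv (deriv u)) t = ((1 / 2) * deriv (deriv W) (u t)) * deriv u t := by
    intro t
    rw [funext hode]
    have h1 : HasDerivAt (deriv W) (deriv (deriv W) (u t)) (u t) :=
      (hW'.differentiable (by simp) _).hasDerivAt
    have h2 : HasDerivAt u (deriv u t) t := (hu.differentiable (by simp) _).hasDerivAt
    have h3 := (h1.comp t h2).const_mul (1 / 2 : ℝ)
    have h4 := h3.deriv
    simp only [Function.comp_def] at h4
    rw [h4]; ring
  have hVc : Continuous (fun t => (1 / 2) * deriv (deriv W) (u t)) :=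
    continuous_const.mul (hW''.continuous.comp hu.continuous)
  obtain ⟨m, T, hm, hV⟩ : ∃ m T : ℝ, 0 < m ∧ ∀ t, T ≤ |t| → m ≤ (1 / 2) * deriv (deriv W) (u t) := by
    have l1 := (hW''.continuous.tendsto 1).comp hlimtop
    have l2 := (hW''.continuous.tendsto (-1)).comp hlimbot
    set m0 := min (deriv (deriv W) 1) (deriv (deriv W) (-1)) with hm0
    have hm0p : 0 < m0 := lt_min hW''1 hW''m1
    have e1 := l1.eventually (lt_mem_nhds (show m0 / 2 < deriv (deriv W) 1 by
      have := min_le_left (deriv (deriv W) 1) (deriv (deriv W) (-1)); linarith))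
    have e2 := l2.eventually (lt_mem_nhds (show m0 / 2 < deriv (deriv W) (-1) by
      have := min_le_right (deriv (deriv W) 1) (deriv (deriv W) (-1)); linarith))
    obtain ⟨T1, hT1⟩ := eventually_atTop.1 e1
    obtain ⟨T2, hT2⟩ := eventually_atBot.1 e2
    refine ⟨m0 / 4, max T1 (-T2), by positivity, fun t ht => ?_⟩
    have a1 := (le_max_left T1 (-T2)).trans ht
    have a2 := (le_max_right T1 (-T2)).trans ht
    rcases abs_cases t with ⟨h, _⟩ | ⟨h, _⟩
    · have := hT1 t (by linarith)
      simp only [Function.comp_apply] at this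
      linarith
    · have := hT2 t (by linarith)
      simp only [Function.comp_apply] at this
      linarith
  obtain ⟨M, hM⟩ : ∃ M, ∀ t, deriv u t ≤ M := by
    obtain ⟨M, hM⟩ := (isCompact_Icc.image_of_continuousOn
      (hW.continuous.continuousOn (s := Icc (-1 : ℝ) 1))).bddAbove
    refine ⟨M + 1, fun t => ?_⟩
    have h1 : W (u t) ≤ M := hM ⟨u t, ⟨(hbd t).1.le, (hbd t).2.le⟩, rfl⟩
    rw [← hfirst t] at h1
    nlinarith [sq_nonneg (deriv u t - 1 / 2)]
  have hL : ∀ p : ℝ × EuclideanSpace ℝ (Fin n),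
      LL (fun t => (1 / 2) * deriv (deriv W) (u t)) (fun p => w p.1 p.2) p = 0 := by
    rintro ⟨t, z⟩
    have h := heq t z
    have e1 : D2 (fun p : ℝ × EuclideanSpace ℝ (Fin n) => w p.1 p.2) (t, z) (1, 0)
        = deriv (deriv (fun s => w s z)) t := by
      have := dd_mul_const (fun s => w s z) 1 t
      simpa [D2] using this
    have hc : ContDiff ℝ 2 (w t) := hwreg.comp (contDiff_const.prodMk contDiff_id)
    have e2 : ∑ i : Fin n, D2 (fun p : ℝ × EuclideanSpace ℝ (Fin n) => w p.1 p.2) (t, z)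
        (0, EuclideanSpace.single i 1) = euclLap n (w t) z := by
      unfold euclLap
      refine Finset.sum_congr rfl fun i _ => ?_
      rw [D2_eq_fderiv hc]
      simp [D2]
    unfold LL
    rw [e1, e2]
    exact h
  obtain ⟨c, hc⟩ := abstract_main hφ hpos hφode hVc hm hV hM hwreg hL (fun p => hbound p.1 p.2)
  exact ⟨c, fun t z => hc (t, z)⟩
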